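/- arXiv:0802.0734 — 2 statements merged into one kernel-verified Lean document; each statement's English description precedes it below -/
import Mathlib

section
/- Let V be a Jordan triple system, let w ∈ V be a maximal tripotent, and let u, v ∈ V be tripotents with D(w,w)u = u/2 (u ∈ V_1(w)), D(w,w)v = v (v ∈ V_2(w)), and D(u,u)v = v/2 (v ∈ V_1(u)). Then every x ∈ V with D(w,w)x = x/2 and D(u,u)x = 0 satisfies D(x,x)v = 0 (so that, in a JB*-triple, x is orthogonal to v; this is the content of the inclusion V_1(w) ∩ V_0(u) ⊆ V_0(v)). -/
/-- A Jordan triple system: a complex vector space with a triple product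
symmetric and linear in the outer variables, conjugate-linear in the middle
variable, satisfying the Jordan triple (main) identity. -/
structure JordanTriple (V : Type*) [AddCommGroup V] [Module ℂ V] where
  tp : V → V → V → V
  symm_outer : ∀ a b c, tp a b c = tp c b a
  add_fst : ∀ a a' b c, tp (a + a') b c = tp a b c + tp a' b c
  smul_fst : ∀ (r : ℂ) (a b c : V), tp (r • a) b c = r • tp a b c
  add_snd : ∀ a b b' c, tp a (b + b') c = tp a b c + tp a b' c
  smul_snd : ∀ (r : ℂ) (a b c : V), tp a (r • b) c = (starRingEnd ℂ r) • tp a b c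
  jordan_identity : ∀ a b x y z,
    tp a b (tp x y z) = tp (tp a b x) y z - tp x (tp b a y) z + tp x y (tp a b z)

namespace JordanTriple

variable {V : Type*} [AddCommGroup V] [Module ℂ V]

/-- A tripotent: `{e,e,e} = e`. -/
def IsTripotent (T : JordanTriple V) (e : V) : Prop := T.tp e e e = e

/-- Orthogonality of elements: `D(x,y) = 0` and `D(y,x) = 0`. -/
def Orthogonal (T : JordanTriple V) (x y : V) : Prop :=
  (∀ z, T.tp x y z = 0) ∧ (∀ z, T.tp y x z = 0)

/-- A maximal (complete) tripotent: the Peirce projection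
`P₀(w) = I - 2 D(w,w) + Q(w)²` vanishes on `V`. -/
def IsMaximalTripotent (T : JordanTriple V) (w : V) : Prop :=
  T.IsTripotent w ∧ ∀ z : V, z - (2 : ℂ) • T.tp w w z + T.tp w (T.tp w z w) w = 0

/-- Orthogonality is symmetric: `D(a,a)b = 0` implies `D(b,b)a = 0`
(true in every JB*-triple). -/
def OrthSymm (T : JordanTriple V) : Prop :=
  ∀ a b : V, T.tp a a b = 0 → T.tp b b a = 0

end JordanTriple

variable {V : Type*} [AddCommGroup V] [Module ℂ V]

open JordanTriple

namespace JordanTriple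

theorem tp_zero_fst (T : JordanTriple V) (b c : V) : T.tp 0 b c = 0 := by
  simpa using T.smul_fst 0 0 b c

theorem tp_zero_snd (T : JordanTriple V) (a c : V) : T.tp a 0 c = 0 := by
  simpa using T.smul_snd 0 a 0 c

theorem tp_zero_thd (T : JordanTriple V) (a b : V) : T.tp a b 0 = 0 := by
  rw [T.symm_outer, tp_zero_fst]

theorem smul_thd (T : JordanTriple V) (r : ℂ) (a b c : V) :
    T.tp a b (r • c) = r • T.tp a b c := by
  rw [T.symm_outer, T.smul_fst, T.symm_outer]

/-- The quadratic operator `Q(e)` of a tripotent `e` vanishes on `V₀(e)`. -/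
theorem IsTripotent.quadratic_eq_zero {T : JordanTriple V} {e y : V}
    (he : T.IsTripotent e) (hy : T.tp e e y = 0) : T.tp e y e = 0 := by
  have he' : T.tp e e e = e := he
  have hy' : T.tp y e e = 0 := by rw [T.symm_outer, hy]
  have hD := T.jordan_identity e e e y e
  have hQ := T.jordan_identity e y e e e
  rw [he', hy, tp_zero_snd] at hD
  rw [he', hy', tp_zero_snd, T.symm_outer (T.tp e y e) e e, hD] at hQ
  have h3 : (3 : ℂ) • T.tp e y e = 0 := by linear_combination (norm := module) -hQ
  simpa using h3

/-- If `e` is a tripotent and `y ∈ V₀(e)`, then `D(e,y) = 0`. -/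
theorem IsTripotent.tp_eq_zero {T : JordanTriple V} {e y : V}
    (he : T.IsTripotent e) (hy : T.tp e e y = 0) (z : V) : T.tp e y z = 0 := by
  have he' : T.tp e e e = e := he
  have hy' : T.tp y e e = 0 := by rw [T.symm_outer, hy]
  have hD := T.jordan_identity e e e y z
  have hQ := T.jordan_identity e y e e z
  rw [he', hy, tp_zero_snd] at hD
  rw [he.quadratic_eq_zero hy, hy', tp_zero_fst, tp_zero_snd] at hQ
  linear_combination (norm := module) -hD - hQ

/-- The Peirce space `V₀(w)` of a maximal tripotent `w` is trivial. -/
theorem IsMaximalTripotent.eq_zero {T : JordanTriple V} {w y : V}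
    (hw : T.IsMaximalTripotent w) (hy : T.tp w w y = 0) : y = 0 := by
  simpa [hy, hw.1.quadratic_eq_zero hy, tp_zero_snd, tp_zero_fst] using hw.2 y

/-- For a maximal tripotent `w`, `{V₁(w), V₂(w), V₁(w)} = 0`. -/
theorem IsMaximalTripotent.tp_one_two_one {T : JordanTriple V} {w a b c : V}
    (hw : T.IsMaximalTripotent w) (ha : T.tp w w a = (1/2 : ℂ) • a)
    (hb : T.tp w w b = b) (hc : T.tp w w c = (1/2 : ℂ) • c) : T.tp a b c = 0 := by
  apply hw.eq_zero
  rw [T.jordan_identity, ha, hb, hc, T.smul_fst, smul_thd]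
  module

end JordanTriple

/-- If `w` is a maximal tripotent and `u, v` are tripotents with `u ∈ V₁(w)`,
`v ∈ V₂(w)` and `v ∈ V₁(u)`, then every `x ∈ V₁(w) ∩ V₀(u)` satisfies
`D(x,x)v = 0`. -/
theorem peirce_one_cap_zero_kills_v (T : JordanTriple V) (w u v : V)
    (hw : T.IsMaximalTripotent w) (hu : T.IsTripotent u) (hv : T.IsTripotent v)
    (h1 : T.tp w w u = (1/2 : ℂ) • u)
    (h2 : T.tp w w v = v)
    (h3 : T.tp u u v = (1/2 : ℂ) • v) :
    ∀ x : V, T.tp w w x = (1/2 : ℂ) • x → T.tp u u x = 0 →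
      T.tp x x v = 0 := by
  intro x hx hux
  have huv : T.tp u v x = 0 := hw.tp_one_two_one h1 h2 hx
  have h := T.jordan_identity v u u x x
  rw [hu.tp_eq_zero hux, hu.tp_eq_zero hux, huv, tp_zero_thd, tp_zero_snd,
    T.symm_outer v u u, h3, T.smul_fst, T.symm_outer v x x] at h
  simpa using h.symm
end

section
/- Let V be a Jordan triple system, let w ∈ V be a maximal tripotent, and let u ∈ V be a tripotent with D(w,w)u = u/2. Then w_u := 2{u,u,w} is a tripotent such that: (a) w − w_u is a tripotent orthogonal to w_u (w_u ≤ w); (b) u and w_u are collinear, i.e., D(u,u)w_u = w_u/2 and D(w_u,w_u)u = u/2; and (c) u and w_u are rigidly collinear, i.e., every x with D(u,u)x = x satisfies D(w_u,w_u)x = x/2, and every x with D(w_u,w_u)x = x satisfies D(u,u)x = x/2. -/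
variable {V : Type*} [AddCommGroup V] [Module ℂ V]

open JordanTriple

namespace JordanTriple

variable (T : JordanTriple V)

lemma add_trd (a b c c' : V) : T.tp a b (c + c') = T.tp a b c + T.tp a b c' := by
  rw [T.symm_outer, T.add_fst, T.symm_outer c, T.symm_outer c']

lemma smul_trd (r : ℂ) (a b c : V) : T.tp a b (r • c) = r • T.tp a b c := by
  rw [T.symm_outer, T.smul_fst, T.symm_outer c]

lemma zero_fst (b c : V) : T.tp 0 b c = 0 := by
  simpa using T.smul_fst 0 0 b c

lemma zero_snd (a c : V) : T.tp a 0 c = 0 := by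
  simpa using T.smul_snd 0 a 0 c

lemma zero_trd (a b : V) : T.tp a b 0 = 0 := by
  simpa using T.smul_trd 0 a b 0

lemma sub_trd (a b c c' : V) : T.tp a b (c - c') = T.tp a b c - T.tp a b c' := by
  have h := T.add_trd a b (c - c') c'
  rw [sub_add_cancel] at h
  exact eq_sub_of_add_eq h.symm

lemma two_smul_snd (a b c : V) : T.tp a ((2 : ℂ) • b) c = (2 : ℂ) • T.tp a b c := by
  rw [T.smul_snd, map_ofNat]

lemma half_smul_snd (a b c : V) : T.tp a ((1/2 : ℂ) • b) c = (1/2 : ℂ) • T.tp a b c := by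
  rw [T.smul_snd, map_div₀, map_one, map_ofNat]

/-- The two ways of expanding the commutator `[D(a,b), D(x,y)]` agree. -/
lemma commutator_eq (a b x y z : V) :
    T.tp (T.tp a b x) y z - T.tp x (T.tp b a y) z =
      T.tp a (T.tp y x b) z - T.tp (T.tp x y a) b z := by
  linear_combination (norm := module)
    -(T.jordan_identity a b x y z) - T.jordan_identity x y a b z

lemma D_conj {a e : V} (ha : T.tp a a e = (1/2 : ℂ) • e) (y : V) :
    T.tp e (T.tp a a y) e = T.tp e y e - T.tp a a (T.tp e y e) := by
  have h := T.jordan_identity a a e y e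
  rw [ha, T.smul_fst, T.smul_trd] at h
  linear_combination (norm := module) h

variable {T}

namespace IsTripotent

variable {e : V}

lemma quadratic_mid (he : T.IsTripotent e) (z : V) :
    T.tp e (T.tp e e z) e = T.tp e z e := by
  have h1 := T.jordan_identity e z e e e
  have h2 := T.jordan_identity e e e z e
  rw [T.symm_outer z e e] at h1
  rw [T.symm_outer e e (T.tp e z e)] at h1
  rw [T.symm_outer (T.tp e z e) e e] at h1
  simp only [show T.tp e e e = e from he] at h1 h2
  linear_combination (norm := module) (1/3 : ℂ) • h1 + (2/3 : ℂ) • h2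

lemma D_quadratic (he : T.IsTripotent e) (z : V) :
    T.tp e e (T.tp e z e) = T.tp e z e := by
  have h2 := T.jordan_identity e e e z e
  simp only [show T.tp e e e = e from he, quadratic_mid he] at h2
  linear_combination (norm := module) h2

lemma quadratic_quadratic (he : T.IsTripotent e) (z : V) :
    T.tp e (T.tp e z e) e = (2 : ℂ) • T.tp e e (T.tp e e z) - T.tp e e z := by
  have h := T.jordan_identity z e e e e
  simp only [show T.tp e e e = e from he, T.symm_outer z e e,
    T.symm_outer (T.tp e e z) e e] at h
  linear_combination (norm := module) h

lemma D_cubic (he : T.IsTripotent e) (z : V) :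
    (2 : ℂ) • T.tp e e (T.tp e e (T.tp e e z)) - (3 : ℂ) • T.tp e e (T.tp e e z)
      + T.tp e e z = 0 := by
  have h := D_quadratic he (T.tp e z e)
  simp only [quadratic_quadratic he, T.sub_trd, T.smul_trd] at h
  linear_combination (norm := module) h

lemma quadratic_eq_zero_of_zero (he : T.IsTripotent e) {z : V}
    (hz : T.tp e e z = 0) : T.tp e z e = 0 := by
  rw [← quadratic_mid he z, hz, T.zero_snd]

lemma quadratic_quadratic_of_two (he : T.IsTripotent e) {x : V} (hx : T.tp e e x = x) :
    T.tp e (T.tp e x e) e = x := by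
  rw [quadratic_quadratic he, hx, hx]
  module

/-- Elements of the Peirce 0-space of `e` are orthogonal to `e`. -/
lemma orthogonal_of_zero (he : T.IsTripotent e) {z : V} (hz : T.tp e e z = 0) :
    T.Orthogonal z e := by
  have hq := quadratic_eq_zero_of_zero he hz
  constructor
  · intro y
    have h := T.commutator_eq e e z e y
    simp only [hz, show T.tp e e e = e from he, hq, T.symm_outer z e e, T.zero_fst,
      T.zero_snd] at h
    linear_combination (norm := module) -h
  · intro y
    have h := T.commutator_eq e e e z y
    simp only [hz, show T.tp e e e = e from he, hq, T.symm_outer z e e, T.zero_fst,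
      T.zero_snd] at h
    linear_combination (norm := module) h

/-- The Peirce 2-space and the Peirce 0-space of a tripotent are orthogonal. -/
lemma orthogonal_of_two_of_zero (he : T.IsTripotent e) {x z : V} (hx : T.tp e e x = x)
    (hz : T.tp e e z = 0) : T.Orthogonal x z := by
  obtain ⟨hze, hez⟩ := orthogonal_of_zero he hz
  have hzx : ∀ y, T.tp z x y = 0 := by
    intro y
    have h := T.jordan_identity (T.tp e x e) e z e y
    rw [quadratic_quadratic_of_two he hx, T.symm_outer (T.tp e x e) e z] at h
    simp only [hze, T.zero_fst, T.zero_trd] at h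
    linear_combination (norm := module) h
  refine ⟨fun y => ?_, hzx⟩
  have h := T.commutator_eq e e x z y
  simp only [hx, hz, hzx, T.symm_outer x z e, hez, T.zero_fst, T.zero_snd] at h
  linear_combination (norm := module) h

/-- If `D(a,a)e = e/2`, conjugation by `Q(e)` sends `D(a,a)` to `I - D(a,a)` on the
Peirce 2-space of `e`, so `D(a,a)` is `1/2` there as soon as `0` is not an eigenvalue. -/
lemma D_eq_half_of_two (he : T.IsTripotent e) {a : V}
    (ha : T.tp a a e = (1/2 : ℂ) • e)
    (hA : ∀ x, T.tp e e x = x →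
      x - (3 : ℂ) • T.tp a a x + (2 : ℂ) • T.tp a a (T.tp a a x) = 0)
    {x : V} (hx : T.tp e e x = x) : T.tp a a x = (1/2 : ℂ) • x := by
  have key := T.D_conj ha
  set y := T.tp e x e
  have hyx : T.tp e y e = x := quadratic_quadratic_of_two he hx
  have h1 := key y
  have h2 := key (T.tp a a y)
  rw [h1, hyx, T.sub_trd] at h2
  have h := T.add_snd e (y - (3 : ℂ) • T.tp a a y) ((2 : ℂ) • T.tp a a (T.tp a a y)) e
  have h' := T.add_snd e (y - (3 : ℂ) • T.tp a a y) ((3 : ℂ) • T.tp a a y) e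
  rw [sub_add_cancel, T.smul_snd, map_ofNat, h1, hyx] at h'
  rw [hA y (D_quadratic he x), T.zero_snd, T.two_smul_snd, h2] at h
  linear_combination (norm := module) (-1/2 : ℂ) • (hA x hx + h - h')

end IsTripotent

end JordanTriple

/-- Proposition: if `w` is a maximal tripotent and `u` a tripotent with
`D(w,w)u = u/2`, then `w_u := 2{u,u,w}` is a tripotent with `w_u ≤ w`, which is
collinear and in fact rigidly collinear with `u`. -/
theorem wu_rigidly_collinear (T : JordanTriple V) (w u : V)
    (hw : T.IsMaximalTripotent w) (hu : T.IsTripotent u)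
    (h1 : T.tp w w u = (1/2 : ℂ) • u)
    (wu : V) (hwu : wu = (2 : ℂ) • T.tp u u w) :
    T.IsTripotent wu ∧
    (T.IsTripotent (w - wu) ∧ T.Orthogonal (w - wu) wu) ∧
    (T.tp u u wu = (1/2 : ℂ) • wu ∧ T.tp wu wu u = (1/2 : ℂ) • u) ∧
    (∀ x : V, T.tp u u x = x → T.tp wu wu x = (1/2 : ℂ) • x) ∧
    (∀ x : V, T.tp wu wu x = x → T.tp u u x = (1/2 : ℂ) • x) := by
  obtain ⟨hwt, hmax⟩ := hw
  have hwt' : T.tp w w w = w := hwt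
  have hu' : T.tp u u u = u := hu
  have hmax2 : ∀ z, z - (3 : ℂ) • T.tp w w z + (2 : ℂ) • T.tp w w (T.tp w w z) = 0 := by
    intro z
    have h := hmax z
    rw [hwt.quadratic_quadratic] at h
    linear_combination (norm := module) h
  -- `{u,w,u}` lies in the Peirce 0-space of `w`, which is trivial
  have huwu : T.tp u w u = 0 := by
    have h := T.jordan_identity w w u w u
    rw [hwt', h1, T.smul_fst, T.smul_trd] at h
    have h0 : T.tp w w (T.tp u w u) = 0 := by linear_combination (norm := module) h
    simpa [h0, T.zero_trd] using hmax2 (T.tp u w u)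
  have hDDw : T.tp u u (T.tp u u w) = (1/2 : ℂ) • T.tp u u w := by
    have h := hu.quadratic_quadratic w
    rw [huwu, T.zero_snd] at h
    linear_combination (norm := module) (-1/2 : ℂ) • h
  have hDwu : T.tp u u wu = (1/2 : ℂ) • wu := by
    rw [hwu, T.smul_trd, hDDw]
    module
  obtain ⟨v, hv⟩ : ∃ v, v = w - wu := ⟨_, rfl⟩
  have hw_add : w = wu + v := by rw [hv]; abel
  have hDv : T.tp u u v = 0 := by
    rw [hv, T.sub_trd, hDwu, hwu]
    module
  obtain ⟨hvu, huv⟩ := hu.orthogonal_of_zero hDv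
  have huwuv : T.tp wu v u = 0 := by rw [T.symm_outer, huv]
  have hexp : ∀ x, T.tp w w x =
      T.tp wu wu x + T.tp wu v x + T.tp v wu x + T.tp v v x := by
    intro x
    rw [hw_add]
    simp only [T.add_fst, T.add_snd]
    abel
  have hsum : T.tp wu wu u + T.tp v wu u = (1/2 : ℂ) • u := by
    rw [← h1, hexp, huwuv, T.symm_outer v v u, huv]
    abel
  have hvwuu : T.tp v wu u = 0 := by
    have h2 := T.jordan_identity u u v wu u
    have h3 := T.jordan_identity u u wu wu u
    have h4 := congrArg (T.tp u u) hsum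
    simp only [T.add_trd, T.smul_trd, hDv, hDwu, hu', T.zero_fst, T.smul_fst,
      T.half_smul_snd] at h2 h3 h4
    linear_combination (norm := module) (2 : ℂ) • (hsum - h4 + h2 + h3)
  have hcol : T.tp wu wu u = (1/2 : ℂ) • u := by rw [← hsum, hvwuu, add_zero]
  have hvwuwu : T.tp v wu wu = 0 := by
    have h2 := T.jordan_identity u u v wu wu
    have h3 := T.jordan_identity v wu u u wu
    simp only [hDv, hDwu, T.zero_fst, T.smul_trd, T.half_smul_snd] at h2
    simp only [hDwu, hvwuu, huwuv, T.zero_fst, T.smul_trd, T.zero_snd] at h3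
    linear_combination (norm := module) (2 : ℂ) • (h3 + h2)
  have hwuvwu : T.tp wu v wu = 0 := by
    have h2 := T.jordan_identity u u wu v wu
    have h3 := T.jordan_identity wu v u u wu
    simp only [hDv, hDwu, T.zero_snd, T.smul_trd, T.smul_fst] at h2
    simp only [hDwu, hvwuu, huwuv, T.zero_fst, T.smul_trd, T.zero_snd] at h3
    linear_combination (norm := module) (-2 : ℂ) • (h3 + h2)
  have hvwuv : T.tp v wu v = 0 := by
    have h2 := T.jordan_identity u u v wu v
    simp only [hDv, hDwu, T.zero_fst, T.zero_trd, T.half_smul_snd] at h2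
    have h3 := hu.D_cubic (T.tp v wu v)
    have h4 : T.tp u u (T.tp v wu v) = (-1/2 : ℂ) • T.tp v wu v := by
      linear_combination (norm := module) h2
    simp only [h4, T.smul_trd] at h3
    linear_combination (norm := module) (-2/3 : ℂ) • h3
  have hDwwu : T.tp w w wu = wu := by
    have h2 := T.jordan_identity w w u u w
    rw [h1, hwt', T.smul_fst, T.half_smul_snd] at h2
    rw [hwu, T.smul_trd, h2]
    module
  have hDww1 : T.tp wu wu wu + T.tp v v wu = wu := by
    have h := hexp wu
    rw [hDwwu, hwuvwu, hvwuwu] at h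
    linear_combination (norm := module) -h
  have hwv : T.tp w w v = v := by rw [hv, T.sub_trd, hwt', hDwwu]
  have hvvwu : T.tp v v wu = 0 := by
    have h := hexp v
    rw [hwv, T.symm_outer wu wu v, hvwuwu, T.symm_outer wu v v, hvwuv] at h
    have h2 := T.jordan_identity u u v v wu
    have h3 := T.jordan_identity u u v v v
    have h4 := congrArg (T.tp u u) h
    simp only [hDv, hDwu, T.zero_fst, T.zero_snd, T.zero_trd, T.smul_trd, T.add_trd] at h2 h3 h4
    linear_combination (norm := module) (-2 : ℂ) • (h4 + h2 + h3)
  have hwut : T.IsTripotent wu := by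
    have h := hDww1
    rwa [hvvwu, add_zero] at h
  have horth : T.Orthogonal v wu :=
    hwut.orthogonal_of_zero (by rw [T.symm_outer, hvwuwu])
  have hvt : T.IsTripotent v := by
    have h := hexp v
    rw [hwv, T.symm_outer wu wu v, hvwuwu, T.symm_outer wu v v, hvvwu, hvwuv] at h
    simp only [zero_add] at h
    exact h.symm
  have hrigid : ∀ x, T.tp u u x = x → T.tp wu wu x = (1/2 : ℂ) • x := by
    have hD : ∀ x, T.tp u u x = x → T.tp w w x = T.tp wu wu x := by
      intro x hx
      obtain ⟨hxv, -⟩ := hu.orthogonal_of_two_of_zero hx hDv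
      rw [hexp, horth.1, horth.2, T.symm_outer v v x, hxv]
      abel
    have hcomm : ∀ x, T.tp u u x = x → T.tp u u (T.tp wu wu x) = T.tp wu wu x := by
      intro x hx
      rw [T.jordan_identity, hDwu, hx, T.smul_fst, T.half_smul_snd]
      module
    intro x hx
    refine hu.D_eq_half_of_two hcol (fun z hz => ?_) hx
    rw [← hD _ (hcomm z hz), ← hD z hz]
    exact hmax2 z
  refine ⟨hwut, ⟨hv ▸ hvt, hv ▸ horth⟩, ⟨hDwu, hcol⟩, hrigid, fun x hx => ?_⟩
  refine hwut.D_eq_half_of_two hDwu (fun z hz => ?_) hx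
  -- the Peirce 0-component of `z` is reflected by `Q(wu)` into both Peirce 2-spaces
  obtain ⟨p, hp⟩ : ∃ p, p = z - (3 : ℂ) • T.tp u u z + (2 : ℂ) • T.tp u u (T.tp u u z) :=
    ⟨_, rfl⟩
  rw [← hp]
  have hcomm : ∀ x, T.tp wu wu x = x → T.tp wu wu (T.tp u u x) = T.tp u u x := by
    intro x hx
    rw [T.jordan_identity, hcol, hx, T.smul_fst, T.half_smul_snd]
    module
  have hp2 : T.tp wu wu p = p := by
    rw [hp]
    simp only [T.add_trd, T.sub_trd, T.smul_trd, hcomm _ (hcomm z hz), hcomm z hz, hz]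
  have hp0 : T.tp u u p = 0 := by
    have h := hu.D_cubic z
    rw [hp]
    simp only [T.add_trd, T.sub_trd, T.smul_trd]
    linear_combination (norm := module) h
  have hq := T.D_conj hDwu p
  rw [hp0, T.zero_snd] at hq
  have hq2 := hrigid (T.tp wu p wu) (by linear_combination (norm := module) hq)
  rw [hwut.D_quadratic] at hq2
  have hq0 : T.tp wu p wu = 0 := by linear_combination (norm := module) (2 : ℂ) • hq2
  rw [← hwut.quadratic_quadratic_of_two hp2, hq0, T.zero_snd]
end
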